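/- Let n ≥ 1 and for j = 1, …, n let A_j, B_j ∈ Mat₂(ℝ) satisfy: det(A_j + t B_j) = 1 for every t ∈ ℝ, the pair (A_j, B_j) is positively winding, i.e. (A_j v) ∧ (B_j v) ≥ 0 for all v ∈ ℝ² and (A_j v₀) ∧ (B_j v₀) > 0 for some v₀ ∈ ℝ². Let M(t) := (A_n + tB_n) ⋯ (A_2 + tB_2)(A_1 + tB_1). If v, w ∈ ℝ² satisfy ⟨B_n B_{n−1} ⋯ B_1 v, w⟩ ≠ 0, then the polynomial f(t) := ⟨M(t) v, w⟩ has degree n with n distinct real roots t_1 < ⋯ < t_n, so that f(t) = ⟨B_n ⋯ B_1 v, w⟩ · ∏_{k=1}^{n}(t − t_k) for all t, and f is strictly log-concave: f(t) f''(t) − (f'(t))² < 0 for every t ∈ ℝ. -/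

import Mathlib

open Matrix Filter Topology

noncomputable section

/-- The wedge product `u ∧ w := u₁w₂ − u₂w₁` of two vectors in `ℝ²`. -/
def wedge (u w : Fin 2 → ℝ) : ℝ := u 0 * w 1 - u 1 * w 0

open Polynomial in
/-- The strict Laguerre inequality for a product of distinct linear factors. -/
theorem laguerre_prod_X_sub_C {ι : Type*} {r : ι → ℝ} (hr : Function.Injective r) (t : ℝ)
    (s : Finset ι) (hs : s.Nonempty) :
    (∏ k ∈ s, (X - C (r k))).eval t *
        (derivative (derivative (∏ k ∈ s, (X - C (r k))))).eval t -
      (derivative (∏ k ∈ s, (X - C (r k)))).eval t ^ 2 < 0 := by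
  classical
  induction s using Finset.induction_on with
  | empty => simp at hs
  | insert a s ha ih =>
    rw [Finset.prod_insert ha]
    have hprod : (∏ k ∈ s, (X - C (r k))).eval t = ∏ k ∈ s, (t - r k) := by
      simp [eval_prod]
    rcases s.eq_empty_or_nonempty with rfl | hne
    · simp
    · specialize ih hne
      generalize ∏ k ∈ s, (X - C (r k)) = g at *
      simp only [derivative_mul, derivative_add, derivative_sub, derivative_X, derivative_C,
        eval_add, eval_mul, eval_sub, eval_X, eval_C, sub_zero, one_mul]
      by_cases hg : g.eval t = 0
      · have hta : t - r a ≠ 0 := by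
          obtain ⟨k, hk, hkt⟩ := Finset.prod_eq_zero_iff.mp (hprod.symm.trans hg)
          intro h
          exact ha (hr (show r a = r k by linarith) ▸ hk)
        nlinarith [mul_neg_of_pos_of_neg (pow_pos (abs_pos.mpr hta) 2) ih, sq_abs (t - r a)]
      · nlinarith [mul_nonpos_of_nonneg_of_nonpos (sq_nonneg (t - r a)) ih.le,
          pow_pos (abs_pos.mpr hg) 2, sq_abs (g.eval t)]

/-- The coefficients of `det (A + t B)` when this determinant is identically `1`. -/
theorem det_coeffs_of_det_affine_eq_one {A B : Matrix (Fin 2) (Fin 2) ℝ}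
    (h : ∀ t : ℝ, (A + t • B).det = 1) :
    A 0 0 * A 1 1 - A 0 1 * A 1 0 = 1 ∧
      A 0 0 * B 1 1 + B 0 0 * A 1 1 - A 0 1 * B 1 0 - B 0 1 * A 1 0 = 0 ∧
      B 0 0 * B 1 1 - B 0 1 * B 1 0 = 0 := by
  have h₀ := h 0
  have h₁ := h 1
  have h₂ := h (-1)
  simp only [Matrix.det_fin_two, Matrix.add_apply, Matrix.smul_apply, smul_eq_mul] at h₀ h₁ h₂
  refine ⟨?_, ?_, ?_⟩ <;> linarith

/-- The wedge `(A v) ∧ (B v)` in coordinates. -/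
theorem wedge_mulVec_mulVec (A B : Matrix (Fin 2) (Fin 2) ℝ) (v : Fin 2 → ℝ) :
    wedge (A.mulVec v) (B.mulVec v) =
      (A 0 0 * v 0 + A 0 1 * v 1) * (B 1 0 * v 0 + B 1 1 * v 1) -
        (A 1 0 * v 0 + A 1 1 * v 1) * (B 0 0 * v 0 + B 0 1 * v 1) := by
  simp [wedge, Matrix.mulVec, dotProduct, Fin.sum_univ_two]

/-- Along an affine curve in `SL₂(ℝ)`, the form `(A v) ∧ (B v)` vanishes only on `ker B`. -/
theorem mulVec_eq_zero_of_wedge_eq_zero {A B : Matrix (Fin 2) (Fin 2) ℝ}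
    (h : ∀ t : ℝ, (A + t • B).det = 1) {v : Fin 2 → ℝ}
    (hv : wedge (A.mulVec v) (B.mulVec v) = 0) : B.mulVec v = 0 := by
  obtain ⟨h₀, h₁, h₂⟩ := det_coeffs_of_det_affine_eq_one h
  rw [wedge_mulVec_mulVec] at hv
  -- `N = A⁻¹ B` is nilpotent, and `hv` says that `v` is an eigenvector of `N`.
  set n₀₀ := A 1 1 * B 0 0 - A 0 1 * B 1 0 with h₀₀
  set n₀₁ := A 1 1 * B 0 1 - A 0 1 * B 1 1 with h₀₁
  set n₁₀ := A 0 0 * B 1 0 - A 1 0 * B 0 0 with h₁₀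
  set n₁₁ := A 0 0 * B 1 1 - A 1 0 * B 0 1 with h₁₁
  have htr : n₀₀ + n₁₁ = 0 := by linear_combination h₁
  have hdet : n₀₀ * n₁₁ - n₀₁ * n₁₀ = 0 := by
    linear_combination (A 0 0 * A 1 1 - A 0 1 * A 1 0) * h₂
  have heig : v 0 * (n₁₀ * v 0 + n₁₁ * v 1) = v 1 * (n₀₀ * v 0 + n₀₁ * v 1) := by
    linear_combination hv
  have hN₀ : n₀₀ * v 0 + n₀₁ * v 1 = 0 := by
    refine pow_eq_zero_iff two_ne_zero |>.mp ?_
    linear_combination -n₀₁ * heig + v 0 * (n₀₀ * v 0 + n₀₁ * v 1) * htr - v 0 ^ 2 * hdet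
  have hN₁ : n₁₀ * v 0 + n₁₁ * v 1 = 0 := by
    refine pow_eq_zero_iff two_ne_zero |>.mp ?_
    linear_combination n₁₀ * heig + v 1 * (n₁₀ * v 0 + n₁₁ * v 1) * htr - v 1 ^ 2 * hdet
  funext i
  fin_cases i
  · simp only [Matrix.mulVec, dotProduct, Fin.sum_univ_two, Fin.zero_eta, Pi.zero_apply]
    linear_combination A 0 0 * hN₀ + A 0 1 * hN₁ - (B 0 0 * v 0 + B 0 1 * v 1) * h₀
  · simp only [Matrix.mulVec, dotProduct, Fin.sum_univ_two, Fin.mk_one, Pi.zero_apply]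
    linear_combination A 1 0 * hN₀ + A 1 1 * hN₁ - (B 1 0 * v 0 + B 1 1 * v 1) * h₀

open Polynomial in
/-- The trajectory of `v` under a product of winding affine `SL₂(ℝ)` curves, as a pair of
polynomials in the time variable. -/
theorem exists_polynomial_trajectory (n : ℕ) (A B : Fin n → Matrix (Fin 2) (Fin 2) ℝ)
    (hdet : ∀ j, ∀ t : ℝ, (A j + t • B j).det = 1)
    (hwind : ∀ j, ∀ v : Fin 2 → ℝ, 0 ≤ wedge ((A j).mulVec v) ((B j).mulVec v))
    (v : Fin 2 → ℝ) :
    ∃ p : Fin 2 → ℝ[X],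
      (∀ i, (p i).natDegree ≤ n) ∧
      (∀ i, (p i).coeff n = ((List.ofFn B).reverse.prod).mulVec v i) ∧
      (∀ i t, (p i).eval t =
        ((List.ofFn fun j => A j + t • B j).reverse.prod).mulVec v i) ∧
      (∀ t, 0 ≤ (wronskian (p 0) (p 1)).eval t ∧
        (1 ≤ n → ((List.ofFn B).reverse.prod).mulVec v ≠ 0 →
          0 < (wronskian (p 0) (p 1)).eval t)) ∧
      (∀ z : ℂ, ∃ S : ℝ, 0 ≤ S ∧
        (aeval z (p 1)).im * (aeval z (p 0)).re - (aeval z (p 1)).re * (aeval z (p 0)).im =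
          z.im * S ∧
        (1 ≤ n → ((List.ofFn B).reverse.prod).mulVec v ≠ 0 → 0 < S)) := by
  induction n with
  | zero =>
    refine ⟨fun i => C (v i), by simp, by simp, by simp, by simp [wronskian], ?_⟩
    intro z
    exact ⟨0, le_rfl, by simp, by simp⟩
  | succ n ih =>
    obtain ⟨p, hdeg, hcoeff, heval, hwr, him⟩ :=
      ih (fun j => A j.castSucc) (fun j => B j.castSucc) (fun j => hdet _) (fun j => hwind _)
    set a := A (Fin.last n) with ha
    set b := B (Fin.last n) with hb
    obtain ⟨h₀, h₁, h₂⟩ := det_coeffs_of_det_affine_eq_one (hdet (Fin.last n))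
    have hprodB : ((List.ofFn B).reverse.prod).mulVec v =
        b.mulVec (((List.ofFn fun j : Fin n => B j.castSucc).reverse.prod).mulVec v) := by
      rw [List.ofFn_succ', List.concat_eq_append, List.reverse_append, List.reverse_singleton,
        List.singleton_append, List.prod_cons, Matrix.mulVec_mulVec]
    have hprodM (t : ℝ) : ((List.ofFn fun j => A j + t • B j).reverse.prod).mulVec v =
        (a + t • b).mulVec (((List.ofFn fun j : Fin n =>
          A j.castSucc + t • B j.castSucc).reverse.prod).mulVec v) := by
      rw [List.ofFn_succ', List.concat_eq_append, List.reverse_append, List.reverse_singleton,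
        List.singleton_append, List.prod_cons, Matrix.mulVec_mulVec]
    set x := ((List.ofFn fun j : Fin n => B j.castSucc).reverse.prod).mulVec v with hx
    have hbase (hne : ((List.ofFn B).reverse.prod).mulVec v ≠ 0) (hn : n = 0) :
        0 < wedge (a.mulVec v) (b.mulVec v) := by
      subst hn
      refine lt_of_le_of_ne (hwind _ v) fun h => hne ?_
      rw [hprodB]
      have hxv : x = v := by simp [hx]
      rw [hxv]
      exact mulVec_eq_zero_of_wedge_eq_zero (hdet (Fin.last 0)) h.symm
    have hx0 (hne : ((List.ofFn B).reverse.prod).mulVec v ≠ 0) : x ≠ 0 := by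
      rintro h
      exact hne (by rw [hprodB, h, Matrix.mulVec_zero])
    refine ⟨fun i => (C (a i 0) + X * C (b i 0)) * p 0 + (C (a i 1) + X * C (b i 1)) * p 1,
      ?_, ?_, ?_, ?_, ?_⟩
    · intro i
      have hlin (k : Fin 2) : ((C (a i k) + X * C (b i k)) * p k).natDegree ≤ n + 1 := by
        rw [add_comm n]
        exact natDegree_mul_le_of_le (by compute_degree) (hdeg k)
      exact natDegree_add_le_of_degree_le (hlin 0) (hlin 1)
    · intro i
      have hc (k : Fin 2) : (p k).coeff (n + 1) = 0 :=
        coeff_eq_zero_of_natDegree_lt (Nat.lt_succ_of_le (hdeg k))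
      rw [hprodB]
      simp [add_mul, mul_assoc, coeff_X_mul, hc, hcoeff, Matrix.mulVec, dotProduct,
        Fin.sum_univ_two, hx]
    · intro i t
      rw [hprodM]
      simp [heval, Matrix.mulVec, dotProduct, Fin.sum_univ_two, mul_comm t]
    · intro t
      have hw := hwind (Fin.last n) fun i => (p i).eval t
      have key : (wronskian ((C (a 0 0) + X * C (b 0 0)) * p 0 + (C (a 0 1) + X * C (b 0 1)) * p 1)
          ((C (a 1 0) + X * C (b 1 0)) * p 0 + (C (a 1 1) + X * C (b 1 1)) * p 1)).eval t =
          (wronskian (p 0) (p 1)).eval t +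
            wedge (a.mulVec fun i => (p i).eval t) (b.mulVec fun i => (p i).eval t) := by
        rw [wedge_mulVec_mulVec]
        simp only [wronskian, derivative_mul, derivative_add, derivative_X, derivative_C,
          eval_add, eval_mul, eval_sub, eval_X, eval_C, zero_add, one_mul, mul_zero, add_zero]
        linear_combination ((p 0).eval t * (derivative (p 1)).eval t -
          (derivative (p 0)).eval t * (p 1).eval t) * (h₀ + t * h₁ + t ^ 2 * h₂)
      rw [key]
      refine ⟨add_nonneg (hwr t).1 hw, fun _ hne => ?_⟩
      rcases Nat.eq_zero_or_pos n with hn | hn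
      · have hb0 := hbase hne hn
        subst hn
        have hpv : (fun i => (p i).eval t) = v := by
          funext i
          simp [heval]
        rw [hpv]
        linarith [(hwr t).1]
      · linarith [(hwr t).2 hn (hx0 hne)]
    · intro z
      obtain ⟨S, hS, hSeq, hSpos⟩ := him z
      have hre := hwind (Fin.last n) fun i => (aeval z (p i)).re
      have him' := hwind (Fin.last n) fun i => (aeval z (p i)).im
      refine ⟨S + wedge (a.mulVec fun i => (aeval z (p i)).re) (b.mulVec fun i => (aeval z (p i)).re)
        + wedge (a.mulVec fun i => (aeval z (p i)).im) (b.mulVec fun i => (aeval z (p i)).im),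
        by linarith, ?_, fun _ hne => ?_⟩
      · rw [mul_add, mul_add, ← hSeq, wedge_mulVec_mulVec, wedge_mulVec_mulVec]
        simp only [map_add, map_mul, aeval_X, aeval_C, Complex.coe_algebraMap, Complex.add_re,
          Complex.add_im, Complex.mul_re, Complex.mul_im, Complex.ofReal_re, Complex.ofReal_im]
        linear_combination ((aeval z (p 1)).im * (aeval z (p 0)).re -
          (aeval z (p 1)).re * (aeval z (p 0)).im) *
            (h₀ + z.re * h₁ + (z.re ^ 2 + z.im ^ 2) * h₂)
      · rcases Nat.eq_zero_or_pos n with hn | hn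
        · have hb0 := hbase hne hn
          subst hn
          have hpv : (fun i => (aeval z (p i)).re) = v := by
            funext i
            rw [eq_C_of_natDegree_le_zero (hdeg i), hcoeff]
            simp [hx]
          rw [hpv]
          linarith
        · linarith [hSpos hn (hx0 hne)]

/-- For a product `M(t) = (A_{n-1} + tB_{n-1}) ⋯ (A_0 + tB_0)` of positively
winding affine `SL₂(ℝ)` curves, if `⟨B_{n-1} ⋯ B_0 v, w⟩ ≠ 0` then the degree-`n`
polynomial `f(t) = ⟨M(t)v, w⟩` has `n` distinct real roots `r 0 < ⋯ < r (n-1)`, so that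
`f(t) = ⟨B_{n-1} ⋯ B_0 v, w⟩ ∏ₖ (t − r k)`, and `f` is strictly log-concave:
`f f'' − (f')² < 0` everywhere. -/
theorem stmt_3 (n : ℕ) (hn : 1 ≤ n) (A B : Fin n → Matrix (Fin 2) (Fin 2) ℝ)
    (hdet : ∀ j, ∀ t : ℝ, (A j + t • B j).det = 1)
    (hwind₀ : ∀ j, ∀ v : Fin 2 → ℝ, 0 ≤ wedge ((A j).mulVec v) ((B j).mulVec v))
    (hwind₁ : ∀ j, ∃ v₀ : Fin 2 → ℝ, 0 < wedge ((A j).mulVec v₀) ((B j).mulVec v₀))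
    (v w : Fin 2 → ℝ)
    (hvw : dotProduct (((List.ofFn B).reverse.prod).mulVec v) w ≠ 0)
    (f : ℝ → ℝ)
    (hf : ∀ t : ℝ,
      f t = dotProduct (((List.ofFn fun j => A j + t • B j).reverse.prod).mulVec v) w) :
    ∃ r : Fin n → ℝ, StrictMono r ∧
      (∀ t : ℝ, f t = dotProduct (((List.ofFn B).reverse.prod).mulVec v) w * ∏ k, (t - r k)) ∧
      (∀ t : ℝ, f t * deriv (deriv f) t - (deriv f t) ^ 2 < 0) := by
  obtain ⟨p, hdeg, hcoeff, heval, hwr, him⟩ := exists_polynomial_trajectory n A B hdet hwind₀ v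
  set c := dotProduct (((List.ofFn B).reverse.prod).mulVec v) w with hc
  have hne : ((List.ofFn B).reverse.prod).mulVec v ≠ 0 := by
    intro h
    rw [hc, h, zero_dotProduct] at hvw
    exact hvw rfl
  have hw : w 0 ≠ 0 ∨ w 1 ≠ 0 := by
    by_contra! h
    exact hvw (by simp [hc, dotProduct, Fin.sum_univ_two, h.1, h.2])
  let P : Polynomial ℝ := p 0 * Polynomial.C (w 0) + p 1 * Polynomial.C (w 1)
  have hfP : f = fun t => P.eval t := by
    funext t
    simp [P, hf, heval, dotProduct, Fin.sum_univ_two]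
  have hPcoeff : P.coeff n = c := by
    simp [P, hcoeff, hc, dotProduct, Fin.sum_univ_two]
  have hPdeg : P.natDegree = n := by
    refine Polynomial.natDegree_eq_of_le_of_coeff_ne_zero ?_ (hPcoeff ▸ hvw)
    refine Polynomial.natDegree_add_le_of_degree_le ?_ ?_ <;>
      exact (Polynomial.natDegree_mul_C_le _ _).trans (hdeg _)
  have hPlead : P.leadingCoeff = c := by rw [Polynomial.leadingCoeff, hPdeg, hPcoeff]
  have hP0 : P ≠ 0 := by
    rintro h
    exact hvw (by rw [← hPcoeff, h, Polynomial.coeff_zero])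
  have hsplits : P.Splits := by
    refine Polynomial.Splits.of_splits_map Complex.ofRealHom (IsAlgClosed.splits _) ?_
    intro z hz
    have hz0 : Polynomial.aeval z P = 0 := by
      have := (Polynomial.mem_roots'.mp hz).2
      rwa [Polynomial.IsRoot, Polynomial.eval_map] at this
    obtain ⟨S, -, hS, hSpos⟩ := him z
    have hre := congrArg Complex.re hz0
    have hii := congrArg Complex.im hz0
    simp only [P, map_add, map_mul, Polynomial.aeval_C, Complex.coe_algebraMap, Complex.add_re,
      Complex.add_im, Complex.mul_re, Complex.mul_im, Complex.ofReal_re, Complex.ofReal_im,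
      Complex.zero_re, Complex.zero_im, mul_zero, sub_zero, zero_add] at hre hii
    have hz : z.im = 0 := by
      have hSne := (hSpos hn hne).ne'
      refine (mul_eq_zero.mp ?_).resolve_right hSne
      rw [← hS]
      rcases hw with h | h
      · refine (mul_eq_zero.mp ?_).resolve_left h
        linear_combination (Polynomial.aeval z (p 1)).im * hre - (Polynomial.aeval z (p 1)).re * hii
      · refine (mul_eq_zero.mp ?_).resolve_left h
        linear_combination (Polynomial.aeval z (p 0)).re * hii - (Polynomial.aeval z (p 0)).im * hre
    exact ⟨z.re, Complex.ext (by simp) (by simp [hz])⟩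
  have hnodup : P.roots.Nodup := by
    refine Multiset.nodup_iff_count_le_one.mpr fun t => ?_
    rw [Polynomial.count_roots]
    by_contra! h
    obtain ⟨h₀, h₁⟩ := (Polynomial.one_lt_rootMultiplicity_iff_isRoot hP0).mp h
    have hpos := (hwr t).2 hn hne
    simp only [P, Polynomial.IsRoot, Polynomial.derivative_add, Polynomial.derivative_mul,
      Polynomial.derivative_C, Polynomial.eval_add, Polynomial.eval_mul, Polynomial.eval_C,
      mul_zero, add_zero] at h₀ h₁
    simp only [Polynomial.wronskian, Polynomial.eval_sub, Polynomial.eval_mul] at hpos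
    refine hpos.ne' ?_
    rcases hw with h | h
    · refine (mul_eq_zero.mp ?_).resolve_left h
      linear_combination (Polynomial.derivative (p 1)).eval t * h₀ - (p 1).eval t * h₁
    · refine (mul_eq_zero.mp ?_).resolve_left h
      linear_combination (p 0).eval t * h₁ - (Polynomial.derivative (p 0)).eval t * h₀
  have hcard : P.roots.toFinset.card = n := by
    rw [Multiset.toFinset_card_of_nodup hnodup, ← hsplits.natDegree_eq_card_roots, hPdeg]
  let r := P.roots.toFinset.orderEmbOfFin hcard
  have hfact : P = Polynomial.C c * ∏ k, (Polynomial.X - Polynomial.C (r k)) := by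
    conv_lhs => rw [hsplits.eq_prod_roots, hPlead]
    have hmap := Finset.prod_map Finset.univ r.toEmbedding
      fun y => Polynomial.X - Polynomial.C y
    rw [Finset.map_orderEmbOfFin_univ, Finset.prod_eq_multiset_prod, Multiset.toFinset_val,
      hnodup.dedup] at hmap
    exact congrArg (Polynomial.C c * ·) hmap
  refine ⟨r, r.strictMono, fun t => ?_, fun t => ?_⟩
  · rw [hfP]
    simp only
    rw [hfact]
    simp [Polynomial.eval_prod]
  · have hd (Q : Polynomial ℝ) : deriv (fun t => Q.eval t) = fun t => Q.derivative.eval t :=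
      funext fun t => Q.deriv
    have hlag := laguerre_prod_X_sub_C r.injective t Finset.univ ⟨⟨0, hn⟩, Finset.mem_univ _⟩
    rw [hfP, hd, hd, hfact]
    simp only [Polynomial.derivative_C_mul, Polynomial.eval_C_mul]
    nlinarith [mul_neg_of_pos_of_neg (pow_pos (abs_pos.mpr hvw) 2) hlag, sq_abs c]
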